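/- Suppose the meromorphic mapping Φ = (φ₁,…,φ_n) admits an algebraic addition theorem. Then each of the n² first-order partial derivatives is algebraically dependent on the n original functions: for every k, p ∈ {1,…,n} there exists a nonzero polynomial P_{kp} ∈ ℂ[z₀, z₁,…,z_n] such that P_{kp}(∂φ_k/∂u_p(u); φ₁(u),…,φ_n(u)) = 0 for every u at which φ₁,…,φ_n and their first-order partial derivatives are analytic. -/

import Mathlib

open MvPolynomial

/-- The partial derivative `∂f/∂u_p` of a function on ℂⁿ. -/
noncomputable def pd {n : ℕ} (f : (Fin n → ℂ) → ℂ) (p : Fin n) (u : Fin n → ℂ) : ℂ :=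
  fderiv ℂ f u (Pi.single p 1)

/-- `f` is meromorphic on ℂⁿ: a quotient of two everywhere-analytic functions. -/
def Mero {n : ℕ} (f : (Fin n → ℂ) → ℂ) : Prop :=
  ∃ g h : (Fin n → ℂ) → ℂ, (∀ u, AnalyticAt ℂ g u) ∧ (∀ u, AnalyticAt ℂ h u) ∧
    (∃ u, h u ≠ 0) ∧ ∀ u, h u ≠ 0 → f u = g u / h u

/-- The Jacobian determinant of the family `φ` is not identically zero. -/
def AnalyticallyIndep {n : ℕ} (φ : Fin n → (Fin n → ℂ) → ℂ) : Prop :=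
  ∃ u : Fin n → ℂ, (∀ j, AnalyticAt ℂ (φ j) u) ∧
    Matrix.det (Matrix.of fun k p => pd (φ k) p u) ≠ 0

/-- `Φ = (φ₁,…,φ_n)` admits an algebraic addition theorem: for each `k` there is a
polynomial `G_k` in the variables `λ` (= `none`), `x_j` (= `some (inl j)`) and
`y_j` (= `some (inr j)`), of degree ≥ 1 in `λ`, with
`G_k(φ_k(u+v); φ(u), φ(v)) = 0` wherever all functions involved are analytic. -/
def AdmitsAAT {n : ℕ} (φ : Fin n → (Fin n → ℂ) → ℂ) : Prop :=
  ∀ k : Fin n, ∃ G : MvPolynomial (Option (Fin n ⊕ Fin n)) ℂ,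
    1 ≤ G.degreeOf none ∧
    ∀ u v : Fin n → ℂ, (∀ j, AnalyticAt ℂ (φ j) u) → (∀ j, AnalyticAt ℂ (φ j) v) →
      AnalyticAt ℂ (φ k) (u + v) →
      eval (fun i => i.elim (φ k (u + v)) (Sum.elim (fun j => φ j u) fun j => φ j v)) G = 0

/-- The valuation sending the variable `none` to `θ(u)` and `some j` to `φ_j(u)`. -/
noncomputable def tval {n : ℕ} (θ : (Fin n → ℂ) → ℂ) (φ : Fin n → (Fin n → ℂ) → ℂ)
    (u : Fin n → ℂ) : Option (Fin n) → ℂ :=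
  fun i => i.elim (θ u) fun j => φ j u

/-- `f` is a rational function on ℂⁿ. -/
def RatFn {n : ℕ} (f : (Fin n → ℂ) → ℂ) : Prop :=
  ∃ P Q : MvPolynomial (Fin n) ℂ, Q ≠ 0 ∧
    ∃ s : Set (Fin n → ℂ), IsOpen s ∧ s.Nonempty ∧
      ∀ u ∈ s, f u = eval u P / eval u Q


theorem alg_dep {n : ℕ} {A : Type} [CommRing A] [IsDomain A] [Algebra ℂ A]
    (a : Fin n → A) (x : Option (Fin n) → A)
    (h : ∀ i, IsAlgebraic (Algebra.adjoin ℂ (Set.range a)) (x i)) :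
    ¬ AlgebraicIndependent ℂ x := by
  intro hx
  have hinj : Function.Injective x := hx.injective
  have h1 : (AlgebraicIndependent.matroid ℂ A).Indep (Set.range x) := by
    rw [AlgebraicIndependent.matroid_indep_iff]
    exact hx.to_subtype_range
  have h2 : Set.range x ⊆ (AlgebraicIndependent.matroid ℂ A).closure (Set.range a) := by
    rw [AlgebraicIndependent.matroid_closure_eq]
    rintro _ ⟨i, rfl⟩
    exact h i
  have h3 := h1.encard_le_eRk_of_subset h2
  rw [Matroid.eRk_closure_eq] at h3
  have h4 := h3.trans (Matroid.eRk_le_encard _ _)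
  rw [← Set.image_univ, ← Set.image_univ, hinj.encard_image] at h4
  have h5 := h4.trans (Set.encard_image_le _ _)
  simp only [Set.encard_univ, ENat.card_eq_coe_fintype_card, Fintype.card_option, Fintype.card_fin] at h5
  norm_cast at h5
  omega

theorem deriv_aeval {σ : Type} {S : Type} [CommRing S] [Algebra ℂ S]
    (f : σ → S) (G : MvPolynomial (Option σ) ℂ) :
    Polynomial.derivative (aeval (fun i : Option σ => i.elim (Polynomial.X : Polynomial S)
      (fun j => Polynomial.C (f j))) G) =
    aeval (fun i : Option σ => i.elim (Polynomial.X : Polynomial S)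
      (fun j => Polynomial.C (f j))) (pderiv none G) := by
  classical
  induction G using MvPolynomial.induction_on with
  | C a =>
    simp [Polynomial.algebraMap_apply]
  | add p q hp hq => simp [hp, hq]
  | mul_X p i hp =>
    rw [map_mul, aeval_X, Polynomial.derivative_mul, hp, pderiv_mul, map_add, map_mul, map_mul, aeval_X]
    cases i <;> simp [pderiv_X]

theorem alg_core {n : ℕ} {A : Type} [CommRing A] [IsDomain A] [Algebra ℂ A]
    (a b : Fin n → A) (c : Fin n → ℂ) (d : A) (k : Fin n)
    (G : Fin n → MvPolynomial (Option (Fin n ⊕ Fin n)) ℂ)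
    (T : MvPolynomial (Option (Fin n ⊕ Fin n)) ℂ)
    (hG : ∀ j, aeval (fun i : Option (Fin n ⊕ Fin n) =>
      i.elim (b j) (Sum.elim a fun l => algebraMap ℂ A (c l))) (G j) = 0)
    (hG' : ∀ j, aeval (fun i : Option (Fin n ⊕ Fin n) =>
      i.elim (b j) (Sum.elim a fun l => algebraMap ℂ A (c l))) (pderiv none (G j)) ≠ 0)
    (hd : aeval (fun i : Option (Fin n ⊕ Fin n) =>
      i.elim (b k) (Sum.elim a fun l => algebraMap ℂ A (c l))) (pderiv none (G k)) * d =
      aeval (fun i : Option (Fin n ⊕ Fin n) =>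
      i.elim (b k) (Sum.elim a fun l => algebraMap ℂ A (c l))) T) :
    ∃ P : MvPolynomial (Option (Fin n)) ℂ, P ≠ 0 ∧
      aeval (fun i : Option (Fin n) => i.elim d b) P = 0 := by
  have ha : ∀ j, a j ∈ Algebra.adjoin ℂ (Set.range a) :=
    fun j => Algebra.subset_adjoin ⟨j, rfl⟩
  have hb : ∀ j, IsAlgebraic (Algebra.adjoin ℂ (Set.range a)) (b j) := by
    intro j
    let f : Fin n ⊕ Fin n → Algebra.adjoin ℂ (Set.range a) :=
      Sum.elim (fun j => ⟨a j, ha j⟩) (fun l => algebraMap ℂ _ (c l))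
    have key : ∀ Q : MvPolynomial (Option (Fin n ⊕ Fin n)) ℂ,
        Polynomial.aeval (b j) (aeval (fun i : Option (Fin n ⊕ Fin n) => i.elim
          (Polynomial.X : Polynomial (Algebra.adjoin ℂ (Set.range a)))
          (fun j => Polynomial.C (f j))) Q) = aeval (fun i : Option (Fin n ⊕ Fin n) =>
      i.elim (b j) (Sum.elim a fun l => algebraMap ℂ A (c l))) Q := by
      intro Q
      induction Q using MvPolynomial.induction_on with
      | C z =>
        simp only [algHom_C]
        rw [IsScalarTower.algebraMap_apply ℂ (Algebra.adjoin ℂ (Set.range a))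
          (Polynomial (Algebra.adjoin ℂ (Set.range a))), Polynomial.algebraMap_apply]
        simp only [Algebra.algebraMap_self, RingHom.id_apply, Polynomial.aeval_C]
        rfl
      | add p q hp hq => rw [map_add, map_add, map_add, hp, hq]
      | mul_X p i hp =>
        rw [map_mul, map_mul, map_mul, hp, aeval_X, aeval_X]
        congr 1
        rcases i with _ | i | i
        · simp
        · simp [f]
        · simp [f]
    refine ⟨_, ?_, (key (G j)).trans (hG j)⟩
    intro h0
    apply hG' j
    rw [← key, ← deriv_aeval, h0]
    simp
  have hL : ∀ Q : MvPolynomial (Option (Fin n ⊕ Fin n)) ℂ,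
      IsAlgebraic (Algebra.adjoin ℂ (Set.range a)) (aeval (fun i : Option (Fin n ⊕ Fin n) =>
      i.elim (b k) (Sum.elim a fun l => algebraMap ℂ A (c l))) Q) := by
    intro Q
    have hc : ∀ z : ℂ, IsAlgebraic (Algebra.adjoin ℂ (Set.range a)) (algebraMap ℂ A z) := 
      fun z => isAlgebraic_algebraMap (algebraMap ℂ (Algebra.adjoin ℂ (Set.range a)) z)
    induction Q using MvPolynomial.induction_on with
    | C z => rw [algHom_C]; exact hc z
    | add p q hp hq => rw [map_add]; exact hp.add hq
    | mul_X p i hp =>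
      rw [map_mul, aeval_X]
      apply hp.mul
      rcases i with _ | i | i
      · exact hb k
      · exact isAlgebraic_algebraMap (⟨a i, ha i⟩ : Algebra.adjoin ℂ (Set.range a))
      · exact hc _
  have hdalg : IsAlgebraic (Algebra.adjoin ℂ (Set.range a)) d := by
    have h1 := hL T
    rw [← hd] at h1
    exact (hL _).of_mul (mem_nonZeroDivisors_of_ne_zero (hG' k)) h1
  have := alg_dep a (fun i : Option (Fin n) => i.elim d b) (by
    rintro (_ | i)
    · exact hdalg
    · exact hb i)
  rw [algebraicIndependent_iff] at this
  push Not at this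
  obtain ⟨P, hP, hP0⟩ := this
  exact ⟨P, hP0, hP⟩

theorem ana_mul_zero {E : Type} [NormedAddCommGroup E] [NormedSpace ℂ E] {U : Set E}
    (hU : IsOpen U) (hc : IsPreconnected U) {f g : E → ℂ}
    (hf : AnalyticOnNhd ℂ f U) (hg : AnalyticOnNhd ℂ g U) (h : ∀ x ∈ U, f x * g x = 0) :
    (∀ x ∈ U, f x = 0) ∨ (∀ x ∈ U, g x = 0) := by
  by_cases h0 : ∀ x ∈ U, f x = 0
  · exact Or.inl h0
  · right
    push Not at h0
    obtain ⟨x, hx, hfx⟩ := h0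
    refine hg.eqOn_zero_of_preconnected_of_eventuallyEq_zero hc hx ?_
    filter_upwards [(hf x hx).continuousAt.eventually_ne hfx, hU.mem_nhds hx] with y hy hyU
    exact (mul_eq_zero.mp (h y hyU)).resolve_left hy

theorem ana_common {E ι : Type} [NormedAddCommGroup E] [NormedSpace ℂ E] {U : Set E}
    (hU : IsOpen U) (hc : IsPreconnected U) (hne : U.Nonempty) (f : ι → E → ℂ)
    (hf : ∀ i, AnalyticOnNhd ℂ (f i) U) (h : ∀ i, ∃ x ∈ U, f i x ≠ 0) (s : Finset ι) :
    ∃ x ∈ U, ∏ i ∈ s, f i x ≠ 0 := by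
  classical
  induction s using Finset.induction_on with
  | empty => obtain ⟨x, hx⟩ := hne; exact ⟨x, hx, by simp⟩
  | insert a s ha ih =>
    by_contra hcon
    push Not at hcon
    obtain ⟨x, hx, hx0⟩ := ih
    obtain ⟨y, hy, hy0⟩ := h a
    rcases ana_mul_zero hU hc (f := f a) (g := fun x => ∏ i ∈ s, f i x) (hf a)
      (fun x hx => Finset.analyticAt_fun_prod s (fun i _ => hf i x hx))
      (fun x hx => by have := hcon x hx; rwa [Finset.prod_insert ha] at this) with h1 | h1
    · exact hy0 (h1 y hy)
    · exact hx0 (h1 x hx)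

/-- The ring of analytic functions on `W`. -/
def anaSub {E : Type} [NormedAddCommGroup E] [NormedSpace ℂ E] (W : Set E) :
    Subalgebra ℂ (W → ℂ) where
  carrier := {f | ∃ F : E → ℂ, AnalyticOnNhd ℂ F W ∧ ∀ w : W, f w = F w}
  mul_mem' := by
    rintro f g ⟨F, hF, hf⟩ ⟨G, hG, hg⟩
    exact ⟨fun x => F x * G x, hF.mul hG, fun w => by simp [hf, hg]⟩
  add_mem' := by
    rintro f g ⟨F, hF, hf⟩ ⟨G, hG, hg⟩
    exact ⟨fun x => F x + G x, hF.add hG, fun w => by simp [hf, hg]⟩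
  algebraMap_mem' := fun r => ⟨fun _ => r, analyticOnNhd_const, fun w => by simp⟩

theorem anaSub_isDomain {E : Type} [NormedAddCommGroup E] [NormedSpace ℂ E] {W : Set E}
    (hU : IsOpen W) (hc : IsPreconnected W) (hne : W.Nonempty) : IsDomain (anaSub W) := by
  have h1 : Nontrivial (anaSub W) := by
    obtain ⟨x, hx⟩ := hne
    refine ⟨0, 1, fun h => ?_⟩
    have := congrFun (congrArg Subtype.val h) ⟨x, hx⟩
    simp at this
  have h2 : NoZeroDivisors (anaSub W) := by
    refine ⟨?_⟩
    rintro ⟨f, F, hF, hf⟩ ⟨g, G, hG, hg⟩ h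
    have h' : ∀ x ∈ W, F x * G x = 0 := by
      intro x hx
      have := congrFun (congrArg Subtype.val h) ⟨x, hx⟩
      simpa [hf, hg] using this
    rcases ana_mul_zero hU hc hF hG h' with h | h
    · left; apply Subtype.ext; funext w; simp [hf, h w w.2]
    · right; apply Subtype.ext; funext w; simp [hg, h w w.2]
  exact (isDomain_iff_noZeroDivisors_and_nontrivial _).mpr ⟨h2, h1⟩

theorem anaSub_aeval {E : Type} [NormedAddCommGroup E] [NormedSpace ℂ E] {W : Set E} {σ : Type}
    (f : σ → anaSub W) (P : MvPolynomial σ ℂ) (w : W) :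
    (aeval f P : anaSub W).1 w = eval (fun i => (f i).1 w) P := by
  induction P using MvPolynomial.induction_on with
  | C z => simp
  | add p q hp hq => simp [hp, hq]
  | mul_X p i hp => simp [hp]

theorem hasFDerivAt_eval {E σ : Type} [NormedAddCommGroup E] [NormedSpace ℂ E] [Fintype σ]
    (f : σ → E → ℂ) (f' : σ → E →L[ℂ] ℂ) (x : E) (hf : ∀ i, HasFDerivAt (f i) (f' i) x)
    (P : MvPolynomial σ ℂ) :
    HasFDerivAt (fun y => eval (fun i => f i y) P)
      (∑ i, eval (fun i => f i x) (pderiv i P) • f' i) x := by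
  classical
  induction P using MvPolynomial.induction_on with
  | C z =>
    simp only [eval_C]
    refine (hasFDerivAt_const (𝕜 := ℂ) z x).congr_fderiv ?_
    ext v
    simp [ContinuousLinearMap.sum_apply]
  | add p q hp hq =>
    simp only [map_add]
    refine (hp.add hq).congr_fderiv ?_
    ext v
    simp [ContinuousLinearMap.sum_apply, add_mul, Finset.sum_add_distrib]
  | mul_X p i hp =>
    simp only [map_mul, eval_X]
    refine (hp.mul (hf i)).congr_fderiv ?_
    ext v
    have h1 : ∑ j, eval (fun i => f i x) p * eval (fun i => f i x) (pderiv j (X i)) * f' j v =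
        eval (fun i => f i x) p * f' i v := by
      rw [Finset.sum_eq_single i]
      · simp
      · intro j _ hj
        simp [pderiv_X_of_ne hj.symm]
      · simp
    simp only [pderiv_mul, map_add, map_mul, eval_X, add_mul, Finset.sum_add_distrib,
      ContinuousLinearMap.sum_apply, ContinuousLinearMap.smul_apply,
      ContinuousLinearMap.add_apply, smul_eq_mul, h1, Finset.mul_sum]
    rw [add_comm]
    congr 1
    exact Finset.sum_congr rfl fun j _ => by ring

theorem totalDegree_pderiv_lt' {σ : Type} (P : MvPolynomial σ ℂ) (i : σ)
    (h : pderiv i P ≠ 0) : (pderiv i P).totalDegree < P.totalDegree := by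
  classical
  have key : ∀ m ∈ (pderiv i P).support, (m.sum fun _ e => e) < P.totalDegree := by
    intro m hm
    have h1 : m + Finsupp.single i 1 ∈ P.support := by
      rw [mem_support_iff] at hm ⊢
      intro h0
      rw [coeff_pderiv, h0, zero_mul] at hm
      exact hm rfl
    have h2 := le_totalDegree h1
    rw [Finsupp.sum_add_index' (by simp) (by simp)] at h2
    simp at h2
    omega
  have hpos : 0 < P.totalDegree := by
    obtain ⟨m, hm⟩ := (support_nonempty).mpr h
    exact lt_of_le_of_lt (Nat.zero_le _) (key m hm)
  rw [totalDegree]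
  exact (Finset.sup_lt_iff hpos).mpr key

theorem eq_C_of_pderiv_zero {σ : Type} (P : MvPolynomial σ ℂ)
    (h : ∀ i, pderiv i P = 0) : ∃ z, P = C z := by
  classical
  refine ⟨coeff 0 P, ?_⟩
  ext m
  rw [coeff_C]
  split_ifs with hm
  · rw [hm]
  · obtain ⟨i, hi⟩ : ∃ i, m i ≠ 0 := by
      by_contra hcon
      push Not at hcon
      exact hm (Finsupp.ext fun i => (hcon i).symm)
    have := coeff_pderiv (i := i) P (m - Finsupp.single i 1)
    rw [h i, coeff_zero, tsub_add_cancel_of_le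
      (Finsupp.single_le_iff.mpr (Nat.one_le_iff_ne_zero.mpr hi))] at this
    rcases mul_eq_zero.mp this.symm with h1 | h1
    · exact h1
    · exact absurd h1 (Nat.cast_add_one_ne_zero _)

theorem min_rel {σ E : Type} (U : Set E) (hne : U.Nonempty) (F : E → σ → ℂ)
    (G : MvPolynomial σ ℂ) (hG : G ≠ 0) (hv : ∀ x ∈ U, eval (F x) G = 0) :
    ∃ H : MvPolynomial σ ℂ, (∀ x ∈ U, eval (F x) H = 0) ∧
      ∃ i, ∃ x ∈ U, eval (F x) (pderiv i H) ≠ 0 := by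
  induction hd : G.totalDegree using Nat.strong_induction_on generalizing G with
  | _ d ih =>
    by_cases hi : ∃ i, ∃ x ∈ U, eval (F x) (pderiv i G) ≠ 0
    · exact ⟨G, hv, hi⟩
    push Not at hi
    by_cases h0 : ∀ i, pderiv i G = 0
    · obtain ⟨z, rfl⟩ := eq_C_of_pderiv_zero G h0
      obtain ⟨x, hx⟩ := hne
      have := hv x hx
      rw [eval_C] at this
      simp [this] at hG
    · push Not at h0
      obtain ⟨i, hi0⟩ := h0
      exact ih _ (hd ▸ totalDegree_pderiv_lt' G i hi0) _ hi0 (hi i) rfl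

theorem Mero.const {n : ℕ} (z : ℂ) : Mero (fun _ : Fin n → ℂ => z) :=
  ⟨fun _ => z, fun _ => 1, fun _ => analyticAt_const, fun _ => analyticAt_const,
    ⟨0, one_ne_zero⟩, fun _ _ => by simp⟩

theorem entire_dense {n : ℕ} {h : (Fin n → ℂ) → ℂ} (ha : ∀ u, AnalyticAt ℂ h u)
    (h0 : ∃ u, h u ≠ 0) : Dense {u | h u ≠ 0} := by
  intro x
  rw [mem_closure_iff_frequently]
  intro hx
  obtain ⟨u, hu⟩ := h0
  apply hu
  have hx' : h =ᶠ[nhds x] 0 := by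
    filter_upwards [hx] with y hy
    simpa using hy
  exact AnalyticOnNhd.eqOn_zero_of_preconnected_of_eventuallyEq_zero (U := Set.univ)
    (fun u _ => ha u) isPreconnected_univ (Set.mem_univ x) hx' (Set.mem_univ u)

theorem entire_mul_ne {n : ℕ} {h k : (Fin n → ℂ) → ℂ} (ha : ∀ u, AnalyticAt ℂ h u)
    (h0 : ∃ u, h u ≠ 0) (ka : ∀ u, AnalyticAt ℂ k u) (k0 : ∃ u, k u ≠ 0) :
    ∃ u, h u * k u ≠ 0 := by
  by_contra hcon
  push Not at hcon
  obtain ⟨u, hu⟩ := h0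
  obtain ⟨v, hv⟩ := k0
  rcases ana_mul_zero isOpen_univ isPreconnected_univ (fun u _ => ha u) (fun u _ => ka u)
    (fun x _ => hcon x) with h1 | h1
  · exact hu (h1 u trivial)
  · exact hv (h1 v trivial)

theorem Mero.add {n : ℕ} {f f' : (Fin n → ℂ) → ℂ} (hf : Mero f) (hf' : Mero f') :
    Mero (fun u => f u + f' u) := by
  obtain ⟨g, h, hg, hh, h0, e⟩ := hf
  obtain ⟨g', h', hg', hh', h0', e'⟩ := hf'
  refine ⟨fun u => g u * h' u + g' u * h u, fun u => h u * h' u,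
    fun u => ((hg u).mul (hh' u)).add ((hg' u).mul (hh u)), fun u => (hh u).mul (hh' u),
    entire_mul_ne hh h0 hh' h0', fun u hu => ?_⟩
  have h1 := left_ne_zero_of_mul hu
  have h2 := right_ne_zero_of_mul hu
  simp only [e u h1, e' u h2]
  field_simp

theorem Mero.mul {n : ℕ} {f f' : (Fin n → ℂ) → ℂ} (hf : Mero f) (hf' : Mero f') :
    Mero (fun u => f u * f' u) := by
  obtain ⟨g, h, hg, hh, h0, e⟩ := hf
  obtain ⟨g', h', hg', hh', h0', e'⟩ := hf'
  refine ⟨fun u => g u * g' u, fun u => h u * h' u,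
    fun u => (hg u).mul (hg' u), fun u => (hh u).mul (hh' u),
    entire_mul_ne hh h0 hh' h0', fun u hu => ?_⟩
  have h1 := left_ne_zero_of_mul hu
  have h2 := right_ne_zero_of_mul hu
  simp only [e u h1, e' u h2]
  field_simp

theorem Mero.evalP {n : ℕ} {σ : Type} {f : σ → (Fin n → ℂ) → ℂ} (hf : ∀ i, Mero (f i))
    (P : MvPolynomial σ ℂ) : Mero (fun u => eval (fun i => f i u) P) := by
  induction P using MvPolynomial.induction_on with
  | C z => simpa using Mero.const z
  | add p q hp hq => simpa using hp.add hq
  | mul_X p i hp => simpa using hp.mul (hf i)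

theorem pd_analyticAt {n : ℕ} {f : (Fin n → ℂ) → ℂ} {u : Fin n → ℂ} (hf : AnalyticAt ℂ f u)
    (p : Fin n) : AnalyticAt ℂ (pd f p) u :=
  ((ContinuousLinearMap.apply ℂ ℂ (Pi.single p (1 : ℂ) : Fin n → ℂ)).analyticAt _).comp hf.fderiv

theorem Mero.pd {n : ℕ} {f : (Fin n → ℂ) → ℂ} (hf : Mero f) (p : Fin n) : Mero (pd f p) := by
  obtain ⟨g, h, hg, hh, h0, e⟩ := hf
  refine ⟨fun u => _root_.pd g p u * h u - g u * _root_.pd h p u, fun u => h u * h u,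
    fun u => ((pd_analyticAt (hg u) p).mul (hh u)).sub ((hg u).mul (pd_analyticAt (hh u) p)),
    fun u => (hh u).mul (hh u), entire_mul_ne hh h0 hh h0, fun u hu => ?_⟩
  have h1 := left_ne_zero_of_mul hu
  have ev : ∀ᶠ v in nhds u, f v = g v / h v := by
    filter_upwards [(hh u).continuousAt.eventually_ne h1] with v hv using e v hv
  have fa : AnalyticAt ℂ f u := ((hg u).div (hh u) h1).congr (ev.mono fun v hv => hv.symm)
  have ev2 : g =ᶠ[nhds u] fun v => f v * h v := by
    filter_upwards [(hh u).continuousAt.eventually_ne h1] with v hv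
    rw [e v hv]; field_simp
  have hd := fa.differentiableAt.hasFDerivAt.mul (hh u).differentiableAt.hasFDerivAt
  have h3 : fderiv ℂ g u = _ := ev2.fderiv_eq.trans hd.fderiv
  have h4 : _root_.pd g p u = f u * _root_.pd h p u + h u * _root_.pd f p u := by
    simp only [_root_.pd]
    rw [h3]; simp
  simp only [h4, e u h1]
  field_simp
  ring

theorem Mero.zero_of_open {n : ℕ} {f : (Fin n → ℂ) → ℂ} (hf : Mero f) {W : Set (Fin n → ℂ)}
    (hW : IsOpen W) (hne : W.Nonempty) (h : ∀ u ∈ W, f u = 0) {u : Fin n → ℂ}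
    (hu : ContinuousAt f u) : f u = 0 := by
  obtain ⟨g, k, hg, hk, h0, e⟩ := hf
  have hdense := entire_dense hk h0
  have hg0 : ∀ x, g x = 0 := by
    by_contra hcon
    push Not at hcon
    obtain ⟨x, hx, hxW⟩ := (entire_dense (fun u => (hg u).mul (hk u))
      (entire_mul_ne hg hcon hk h0)).inter_open_nonempty W hW hne
    have h1 : k x ≠ 0 := right_ne_zero_of_mul hxW
    have h2 : g x ≠ 0 := left_ne_zero_of_mul hxW
    have := e x h1
    rw [h x hx] at this
    exact div_ne_zero h2 h1 this.symm
  by_contra hcon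
  have := hu.eventually_ne hcon
  obtain ⟨x, hx⟩ := ((mem_closure_iff_frequently.mp (hdense u)).and_eventually this).exists
  apply hx.2
  rw [e x hx.1, hg0]; simp

/-- The valuation used in the addition theorem, as a function of `(u, v)`. -/
def Fv {n : ℕ} (φ : Fin n → (Fin n → ℂ) → ℂ) (k : Fin n) (x : (Fin n → ℂ) × (Fin n → ℂ)) :
    Option (Fin n ⊕ Fin n) → ℂ :=
  fun i => i.elim (φ k (x.1 + x.2)) (Sum.elim (fun j => φ j x.1) fun j => φ j x.2)

theorem Fv_analytic {n : ℕ} (φ : Fin n → (Fin n → ℂ) → ℂ) (k : Fin n)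
    (x : (Fin n → ℂ) × (Fin n → ℂ)) (h1 : ∀ j, AnalyticAt ℂ (φ j) x.1)
    (h2 : ∀ j, AnalyticAt ℂ (φ j) x.2) (h3 : ∀ j, AnalyticAt ℂ (φ j) (x.1 + x.2))
    (i : Option (Fin n ⊕ Fin n)) : AnalyticAt ℂ (fun y => Fv φ k y i) x := by
  rcases i with _ | i | i
  · exact AnalyticAt.comp' (f := fun y : (Fin n → ℂ) × (Fin n → ℂ) => y.1 + y.2) (h3 k)
      (analyticAt_fst.add analyticAt_snd)
  · exact (h1 i).comp' analyticAt_fst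
  · exact (h2 i).comp' analyticAt_snd

theorem chain {n : ℕ} (φ : Fin n → (Fin n → ℂ) → ℂ) (k : Fin n)
    (x : (Fin n → ℂ) × (Fin n → ℂ)) (h1 : ∀ j, AnalyticAt ℂ (φ j) x.1)
    (h2 : ∀ j, AnalyticAt ℂ (φ j) x.2) (h3 : ∀ j, AnalyticAt ℂ (φ j) (x.1 + x.2))
    (G : MvPolynomial (Option (Fin n ⊕ Fin n)) ℂ)
    (hv : ∀ᶠ y in nhds x, eval (Fv φ k y) G = 0) (p : Fin n) :
    (eval (Fv φ k x) (pderiv none G) * pd (φ k) p (x.1 + x.2) +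
      ∑ j, eval (Fv φ k x) (pderiv (some (Sum.inl j)) G) * pd (φ j) p x.1 = 0) ∧
    (eval (Fv φ k x) (pderiv none G) * pd (φ k) p (x.1 + x.2) +
      ∑ j, eval (Fv φ k x) (pderiv (some (Sum.inr j)) G) * pd (φ j) p x.2 = 0) := by
  let f' : Option (Fin n ⊕ Fin n) → ((Fin n → ℂ) × (Fin n → ℂ)) →L[ℂ] ℂ := fun i =>
    i.elim ((fderiv ℂ (φ k) (x.1 + x.2)).comp (ContinuousLinearMap.fst ℂ _ _ +
      ContinuousLinearMap.snd ℂ _ _))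
      (Sum.elim (fun j => (fderiv ℂ (φ j) x.1).comp (ContinuousLinearMap.fst ℂ _ _))
        (fun j => (fderiv ℂ (φ j) x.2).comp (ContinuousLinearMap.snd ℂ _ _)))
  have hF : ∀ i, HasFDerivAt (fun y => Fv φ k y i) (f' i) x := by
    rintro (_ | i | i)
    · exact HasFDerivAt.comp (f := fun y : (Fin n → ℂ) × (Fin n → ℂ) => y.1 + y.2) x
        (h3 k).differentiableAt.hasFDerivAt (hasFDerivAt_fst.add hasFDerivAt_snd)
    · exact HasFDerivAt.comp x (h1 i).differentiableAt.hasFDerivAt hasFDerivAt_fst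
    · exact HasFDerivAt.comp x (h2 i).differentiableAt.hasFDerivAt hasFDerivAt_snd
  have hd := hasFDerivAt_eval (fun i y => Fv φ k y i) f' x hF G
  have hz : HasFDerivAt (fun y => eval (fun i => Fv φ k y i) G)
      (0 : ((Fin n → ℂ) × (Fin n → ℂ)) →L[ℂ] ℂ) x :=
    (hasFDerivAt_const (𝕜 := ℂ) (0 : ℂ) x).congr_of_eventuallyEq hv
  have he := hd.unique hz
  have e1 := DFunLike.congr_fun he (Pi.single p 1, 0)
  have e2 := DFunLike.congr_fun he (0, Pi.single p 1)
  simp only [ContinuousLinearMap.sum_apply, ContinuousLinearMap.smul_apply, Fintype.sum_option,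
    Fintype.sum_sum_type, f', Option.elim, Sum.elim_inl, Sum.elim_inr,
    ContinuousLinearMap.comp_apply, ContinuousLinearMap.add_apply,
    ContinuousLinearMap.coe_fst', ContinuousLinearMap.coe_snd', map_zero, smul_zero,
    Finset.sum_const_zero, add_zero, zero_add, smul_eq_mul, mul_zero,
    ContinuousLinearMap.zero_apply] at e1 e2
  exact ⟨e1, e2⟩

theorem exists_min {n : ℕ} (φ : Fin n → (Fin n → ℂ) → ℂ) (k : Fin n)
    (U : Set ((Fin n → ℂ) × (Fin n → ℂ))) (hU : IsOpen U) (hne : U.Nonempty)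
    (h1 : ∀ x ∈ U, ∀ j, AnalyticAt ℂ (φ j) x.1)
    (h2 : ∀ x ∈ U, ∀ j, AnalyticAt ℂ (φ j) x.2)
    (h3 : ∀ x ∈ U, ∀ j, AnalyticAt ℂ (φ j) (x.1 + x.2))
    (d1 : ∀ x ∈ U, Matrix.det (Matrix.of fun k p => pd (φ k) p x.1) ≠ 0)
    (d2 : ∀ x ∈ U, Matrix.det (Matrix.of fun k p => pd (φ k) p x.2) ≠ 0)
    (G : MvPolynomial (Option (Fin n ⊕ Fin n)) ℂ) (hG : G ≠ 0)
    (hv : ∀ x ∈ U, eval (Fv φ k x) G = 0) :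
    ∃ H : MvPolynomial (Option (Fin n ⊕ Fin n)) ℂ, (∀ x ∈ U, eval (Fv φ k x) H = 0) ∧
      ∃ x ∈ U, eval (Fv φ k x) (pderiv none H) ≠ 0 := by
  obtain ⟨H, hH, i, x, hx, hi⟩ := min_rel U hne (Fv φ k) G hG hv
  refine ⟨H, hH, ?_⟩
  by_contra hcon
  push Not at hcon
  have hch := chain φ k x (h1 x hx) (h2 x hx) (h3 x hx) H
    (Filter.mem_of_superset (hU.mem_nhds hx) hH)
  apply hi
  rcases i with _ | i | i
  · exact hcon x hx
  · have := Matrix.eq_zero_of_vecMul_eq_zero (d1 x hx)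
      (v := fun j => eval (Fv φ k x) (pderiv (some (Sum.inl j)) H)) (by
        funext p
        have := (hch p).1
        rw [hcon x hx, zero_mul, zero_add] at this
        simpa [Matrix.vecMul, dotProduct] using this)
    exact congrFun this i
  · have := Matrix.eq_zero_of_vecMul_eq_zero (d2 x hx)
      (v := fun j => eval (Fv φ k x) (pderiv (some (Sum.inr j)) H)) (by
        funext p
        have := (hch p).2
        rw [hcon x hx, zero_mul, zero_add] at this
        simpa [Matrix.vecMul, dotProduct] using this)
    exact congrFun this i

theorem det_continuousAt {n : ℕ} (φ : Fin n → (Fin n → ℂ) → ℂ) (u : Fin n → ℂ)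
    (h : ∀ j, AnalyticAt ℂ (φ j) u) :
    ContinuousAt (fun u => Matrix.det (Matrix.of fun k p => pd (φ k) p u)) u := by
  simp only [Matrix.det_apply]
  refine tendsto_finsetSum _ fun σ _ => ?_
  refine Filter.Tendsto.const_smul ?_ _
  refine tendsto_finsetProd _ fun i _ => ?_
  exact (pd_analyticAt (h _) _).continuousAt

theorem exists_U {n : ℕ} (φ : Fin n → (Fin n → ℂ) → ℂ)
    (hmero : ∀ k, Mero (φ k)) (hindep : AnalyticallyIndep φ) :
    ∃ U : Set ((Fin n → ℂ) × (Fin n → ℂ)), IsOpen U ∧ IsPreconnected U ∧ U.Nonempty ∧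
    (∀ x ∈ U, ∀ j, AnalyticAt ℂ (φ j) x.1) ∧
    (∀ x ∈ U, ∀ j, AnalyticAt ℂ (φ j) x.2) ∧
    (∀ x ∈ U, ∀ j, AnalyticAt ℂ (φ j) (x.1 + x.2)) ∧
    (∀ x ∈ U, Matrix.det (Matrix.of fun k p => pd (φ k) p x.1) ≠ 0) ∧
    (∀ x ∈ U, Matrix.det (Matrix.of fun k p => pd (φ k) p x.2) ≠ 0) := by
  obtain ⟨u, hu, hdet⟩ := hindep
  have ev1 : ∀ᶠ v in nhds u, (∀ j, AnalyticAt ℂ (φ j) v) ∧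
      Matrix.det (Matrix.of fun k p => pd (φ k) p v) ≠ 0 :=
    (Filter.eventually_all.mpr fun j => (hu j).eventually_analyticAt).and
      ((det_continuousAt φ u hu).eventually_ne hdet)
  obtain ⟨O, hO, hOo, huO⟩ := eventually_nhds_iff.mp ev1
  choose g h hg hh h0 he using hmero
  obtain ⟨v, hv⟩ : ∃ v ∈ O, ∀ j, AnalyticAt ℂ (φ j) (u + v) := by
    have ha : ∀ w, ∀ s : Finset (Fin n), AnalyticAt ℂ (fun w => ∏ j ∈ s, h j w) w :=
      fun w s => Finset.analyticAt_fun_prod s (fun i _ => hh i w)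
    have h00 := ana_common (U := Set.univ) isOpen_univ isPreconnected_univ ⟨0, trivial⟩ h
      (fun i x _ => hh i x) (fun i => (h0 i).imp fun x hx => ⟨trivial, hx⟩) Finset.univ
    obtain ⟨w0, -, hw0⟩ := h00
    have hdn := entire_dense (fun w => ha w Finset.univ) ⟨w0, hw0⟩
    have hopen : IsOpen ((fun w => -u + w) ⁻¹' O) := hOo.preimage (by fun_prop)
    obtain ⟨w, hwO, hw⟩ := hdn.inter_open_nonempty _ hopen ⟨u + u, by simpa using huO⟩
    refine ⟨-u + w, hwO, fun j => ?_⟩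
    rw [add_neg_cancel_left]
    have hj : h j w ≠ 0 := (Finset.prod_ne_zero_iff.mp hw) j (Finset.mem_univ j)
    refine ((hg j w).div (hh j w) hj).congr ?_
    filter_upwards [(hh j w).continuousAt.eventually_ne hj] with y hy
    simp [he j y hy]
  have ev : ∀ᶠ x in nhds ((u, v) : (Fin n → ℂ) × (Fin n → ℂ)),
      (x.1 ∈ O ∧ x.2 ∈ O) ∧ ∀ j, AnalyticAt ℂ (φ j) (x.1 + x.2) := by
    refine Filter.Eventually.and (Filter.Eventually.and ?_ ?_) ?_
    · exact continuousAt_fst.eventually_mem (hOo.mem_nhds huO)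
    · exact continuousAt_snd.eventually_mem (hOo.mem_nhds hv.1)
    · have hc : ContinuousAt (fun x : (Fin n → ℂ) × (Fin n → ℂ) => x.1 + x.2) (u, v) := by
        fun_prop
      exact hc.eventually (Filter.eventually_all.mpr fun j => (hv.2 j).eventually_analyticAt)
  obtain ⟨r, hr, hball⟩ := Metric.eventually_nhds_iff_ball.mp ev
  exact ⟨Metric.ball (u, v) r, Metric.isOpen_ball, (convex_ball _ _).isPreconnected,
    ⟨_, Metric.mem_ball_self hr⟩, fun x hx => (hO _ (hball x hx).1.1).1,
    fun x hx => (hO _ (hball x hx).1.2).1, fun x hx => (hball x hx).2,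
    fun x hx => (hO _ (hball x hx).1.1).2, fun x hx => (hO _ (hball x hx).1.2).2⟩

theorem aat_derivative_algebraic_over_functions {n : ℕ} (hn : 1 ≤ n) (φ : Fin n → (Fin n → ℂ) → ℂ)
    (hmero : ∀ k, Mero (φ k)) (hindep : AnalyticallyIndep φ) (haat : AdmitsAAT φ)
    (k p : Fin n) :
    ∃ P : MvPolynomial (Option (Fin n)) ℂ, P ≠ 0 ∧
      ∀ u : Fin n → ℂ, (∀ j, AnalyticAt ℂ (φ j) u) →
        (∀ j q, AnalyticAt ℂ (pd (φ j) q) u) →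
        eval (fun i => i.elim (pd (φ k) p u) fun j => φ j u) P = 0 := by
  obtain ⟨U, hUo, hUc, hUne, h1, h2, h3, d1, d2⟩ := exists_U φ hmero hindep
  have hmin : ∀ j, ∃ H : MvPolynomial (Option (Fin n ⊕ Fin n)) ℂ,
      (∀ x ∈ U, eval (Fv φ j x) H = 0) ∧ ∃ x ∈ U, eval (Fv φ j x) (pderiv none H) ≠ 0 := by
    intro j
    obtain ⟨G, hG, hGv⟩ := haat j
    refine exists_min φ j U hUo hUne h1 h2 h3 d1 d2 G ?_
      (fun x hx => hGv x.1 x.2 (h1 x hx) (h2 x hx) (h3 x hx j))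
    rintro rfl
    simp at hG
  choose H hH hH' using hmin
  have hQa : ∀ (j : Fin n) (Q : MvPolynomial (Option (Fin n ⊕ Fin n)) ℂ),
      AnalyticOnNhd ℂ (fun x => eval (Fv φ j x) Q) U := fun j Q x hx =>
    AnalyticAt.aeval_mvPolynomial (f := Fv φ j)
      (fun i => Fv_analytic φ j x (h1 x hx) (h2 x hx) (h3 x hx) i) Q
  obtain ⟨x0, hx0, hprod⟩ := ana_common hUo hUc hUne
    (fun j x => eval (Fv φ j x) (pderiv none (H j))) (fun j => hQa j _) hH' Finset.univ
  obtain ⟨u0, c⟩ := x0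
  have hne0 : ∀ j, eval (Fv φ j (u0, c)) (pderiv none (H j)) ≠ 0 :=
    fun j => (Finset.prod_ne_zero_iff.mp hprod) j (Finset.mem_univ j)
  have evW : ∀ᶠ w in nhds u0, (w, c) ∈ U := by
    have hc : ContinuousAt (fun w : Fin n → ℂ => (w, c)) u0 := by fun_prop
    exact hc.eventually_mem (hUo.mem_nhds hx0)
  obtain ⟨r, hr, hball⟩ := Metric.eventually_nhds_iff_ball.mp evW
  set W := Metric.ball u0 r with hW
  have hWo : IsOpen W := Metric.isOpen_ball
  have hu0 : u0 ∈ W := Metric.mem_ball_self hr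
  have : IsDomain (anaSub W) :=
    anaSub_isDomain hWo (convex_ball _ _).isPreconnected ⟨u0, hu0⟩
  have hshift : ∀ (f : (Fin n → ℂ) → ℂ) (w : Fin n → ℂ), AnalyticAt ℂ f (w + c) →
      AnalyticAt ℂ (fun w => f (w + c)) w := fun f w hf =>
    AnalyticAt.comp' (f := fun w : Fin n → ℂ => w + c) hf (analyticAt_id.add analyticAt_const)
  let a : Fin n → anaSub W := fun j => ⟨fun w => φ j w, φ j, fun w hw => h1 _ (hball w hw) j,
    fun _ => rfl⟩
  let b : Fin n → anaSub W := fun j => ⟨fun w => φ j (w + c), fun w => φ j (w + c),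
    fun w hw => hshift _ _ (h3 _ (hball w hw) j), fun _ => rfl⟩
  let d : anaSub W := ⟨fun w => pd (φ k) p (w + c), fun w => pd (φ k) p (w + c),
    fun w hw => hshift _ _ (pd_analyticAt (h3 _ (hball w hw) k) p), fun _ => rfl⟩
  have hev : ∀ (j : Fin n) (Q : MvPolynomial (Option (Fin n ⊕ Fin n)) ℂ) (w : W),
      (aeval (fun i : Option (Fin n ⊕ Fin n) =>
      i.elim (b j) (Sum.elim a fun l => algebraMap ℂ (anaSub W) (φ l c))) Q : anaSub W).1 w =
      eval (Fv φ j (w, c)) Q := by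
    intro j Q w
    rw [anaSub_aeval]
    congr 2
    funext i
    rcases i with _ | i | i <;> rfl
  obtain ⟨P, hP0, hP⟩ := alg_core a b (fun l => φ l c) d k H
    (-∑ j, C (pd (φ j) p c) * pderiv (some (Sum.inr j)) (H k))
    (fun j => by
      apply Subtype.ext; funext w
      rw [hev]
      exact hH j _ (hball w w.2))
    (fun j h0 => by
      apply hne0 j
      rw [← hev j _ ⟨u0, hu0⟩, h0]
      rfl)
    (by
      apply Subtype.ext; funext w
      rw [hev]
      change (aeval _ _ : anaSub W).1 w * pd (φ k) p (w + c) = _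
      rw [hev]
      have hx := hball w w.2
      have := (chain φ k (w, c) (h1 _ hx) (h2 _ hx) (h3 _ hx) (H k)
        (Filter.mem_of_superset (hUo.mem_nhds hx) (hH k)) p).2
      rw [eq_neg_of_add_eq_zero_left this]
      simp [mul_comm])
  refine ⟨P, hP0, fun u hu hu' => ?_⟩
  let f : Option (Fin n) → (Fin n → ℂ) → ℂ := fun i => i.elim (pd (φ k) p) φ
  have hfe : ∀ u, (fun i : Option (Fin n) => i.elim (pd (φ k) p u) fun j => φ j u) =
      fun i => f i u := by
    intro u
    funext i
    cases i <;> rfl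
  have hM : Mero (fun u => eval (fun i => f i u) P) := by
    apply Mero.evalP
    rintro (_ | i)
    · exact (hmero k).pd p
    · exact hmero i
  rw [hfe]
  refine hM.zero_of_open (W := (fun w => w - c) ⁻¹' W) (hWo.preimage (by fun_prop))
    ⟨u0 + c, by simpa using hu0⟩ (fun y hy => ?_) ?_
  · have := congrFun (congrArg Subtype.val hP) ⟨y - c, hy⟩
    rw [anaSub_aeval] at this
    rw [← hfe]
    refine Eq.trans ?_ this
    congr 2
    funext i
    cases i <;> simp [b, d]
  · refine (AnalyticAt.aeval_mvPolynomial (𝕜 := ℂ) (f := fun u i => f i u) (z := u) ?_ P).continuousAt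
    rintro (_ | i)
    · exact hu' k p
    · exact hu i
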